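/- Circuit sensitivity is subadditive under multiplication and tensorization: for unitaries U, V on (ℂ^d)^{⊗n}, CiS[UV] ≤ CiS[U] + CiS[V]; and for a unitary U on (ℂ^d)^{⊗n₁} and a unitary V on (ℂ^d)^{⊗n₂}, CiS[U ⊗ V] ≤ CiS[U] + CiS[V], where each CiS is computed on the corresponding space. -/

import Mathlib

open Matrix Complex BigOperators
open scoped ComplexOrder
noncomputable section

namespace QC

/-- Operators on the `n`-qudit space `(ℂ^d)^{⊗n}`, as matrices indexed by
computational basis labels `Fin n → Fin d`. -/
abbrev QOp (d n : ℕ) := Matrix (Fin n → Fin d) (Fin n → Fin d) ℂ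

/-- The qudit shift operator `X`, with `X|j⟩ = |j+1 mod d⟩`. -/
def shiftX (d : ℕ) : Matrix (Fin d) (Fin d) ℂ :=
  fun i j => if (i : ℕ) = ((j : ℕ) + 1) % d then 1 else 0

/-- The qudit clock operator `Z`, with `Z|j⟩ = e^{2πij/d}|j⟩`. -/
def clockZ (d : ℕ) : Matrix (Fin d) (Fin d) ℂ :=
  Matrix.diagonal (fun j => Complex.exp (2 * Real.pi * Complex.I * (j : ℕ) / d))

/-- The single-qudit Pauli operator `P_a = X^s Z^t` for `a = (s,t) ∈ ℤ_d × ℤ_d`. -/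
def pauli1 (d : ℕ) (a : ZMod d × ZMod d) : Matrix (Fin d) (Fin d) ℂ :=
  shiftX d ^ a.1.val * clockZ d ^ a.2.val

/-- The `n`-qudit Pauli operator `P_ā = P_{a_1} ⊗ ⋯ ⊗ P_{a_n}`. -/
def pauliN (d n : ℕ) (a : Fin n → ZMod d × ZMod d) : QOp d n :=
  fun x y => ∏ i, pauli1 d (a i) (x i) (y i)

/-- The weight `|ā|`: the number of indices `i` with `a_i ≠ (0,0)`. -/
def weight (d n : ℕ) (a : Fin n → ZMod d × ZMod d) : ℕ :=
  (Finset.univ.filter (fun i => a i ≠ 0)).card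

/-- `P_O[ā] = |Tr(O P_ā)|² / d^{2n}`. -/
def pdist (d n : ℕ) (O : QOp d n) (a : Fin n → ZMod d × ZMod d) : ℝ :=
  ‖(O * pauliN d n a).trace‖ ^ 2 / (d : ℝ) ^ (2 * n)

/-- The normalized 2-norm `‖O‖₂ = (Tr(O†O)/d^n)^{1/2}`. -/
def l2norm (d n : ℕ) (O : QOp d n) : ℝ :=
  Real.sqrt (((Oᴴ * O).trace).re / (d : ℝ) ^ n)

/-- The total influence `I[O] = Σ_ā |ā|·P_O[ā]`. -/
def influence (d n : ℕ) [NeZero d] (O : QOp d n) : ℝ :=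
  ∑ a : Fin n → ZMod d × ZMod d, (weight d n a : ℝ) * pdist d n O a

/-- The local influence `I_j[O] = Σ_{ā : a_j ≠ 0} P_O[ā]`. -/
def localInfluence (d n : ℕ) [NeZero d] (j : Fin n) (O : QOp d n) : ℝ :=
  ∑ a ∈ Finset.univ.filter (fun a : Fin n → ZMod d × ZMod d => a j ≠ 0), pdist d n O a

/-- The quantum Fourier entropy `H[O] = -Σ_ā P_O[ā] log₂ P_O[ā]` (with `0·log 0 = 0`). -/
def qEntropy (d n : ℕ) [NeZero d] (O : QOp d n) : ℝ :=
  -∑ a : Fin n → ZMod d × ZMod d, pdist d n O a * Real.logb 2 (pdist d n O a)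

/-- The binary entropy `h(x) = -x log₂ x - (1-x) log₂ (1-x)`. -/
def binEntropy (x : ℝ) : ℝ :=
  -(x * Real.logb 2 x) - (1 - x) * Real.logb 2 (1 - x)

/-- Circuit sensitivity `CiS[U] = sup { |I[UOU†] - I[O]| : ‖O‖₂ = 1 }`. -/
def CiS (d n : ℕ) [NeZero d] (U : QOp d n) : ℝ :=
  sSup {x : ℝ | ∃ O : QOp d n, l2norm d n O = 1 ∧
    x = |influence d n (U * O * Uᴴ) - influence d n O|}

/-- Magic power `𝓜[U] = sup { |H[UOU†] - H[O]| : ‖O‖₂ = 1 }`. -/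
def magicPower (d n : ℕ) [NeZero d] (U : QOp d n) : ℝ :=
  sSup {x : ℝ | ∃ O : QOp d n, l2norm d n O = 1 ∧
    x = |qEntropy d n (U * O * Uᴴ) - qEntropy d n O|}

/-- Magic entropy `M[U] = max { H[U P_ā U†] : |ā| = 1 }`. -/
def magicEntropy (d n : ℕ) [NeZero d] (U : QOp d n) : ℝ :=
  sSup {x : ℝ | ∃ a : Fin n → ZMod d × ZMod d, weight d n a = 1 ∧
    x = qEntropy d n (U * pauliN d n a * Uᴴ)}

/-- The operator norm `‖A‖∞` (the L2 → L2 operator norm). -/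
def opNorm (d n : ℕ) (A : QOp d n) : ℝ :=
  ‖Matrix.toEuclideanCLM (𝕜 := ℂ) (n := Fin n → Fin d) A‖

/-- The influence rate `R_I(H,O)`. -/
def influenceRate (d n : ℕ) [NeZero d] (H O : QOp d n) : ℂ :=
  (Complex.I / (d : ℂ) ^ (2 * n)) * ∑ a : Fin n → ZMod d × ZMod d, (weight d n a : ℂ) *
    (((O * H - H * O) * pauliN d n a).trace * (O * (pauliN d n a)ᴴ).trace +
     ((O * H - H * O) * (pauliN d n a)ᴴ).trace * (O * pauliN d n a).trace)

/-- The magic rate `R_M(H,O)`. -/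
def magicRate (d n : ℕ) [NeZero d] (H O : QOp d n) : ℂ :=
  (Complex.I / (d : ℂ) ^ (2 * n)) * ∑ a : Fin n → ZMod d × ZMod d,
    (((O * H - H * O) * pauliN d n a).trace * (O * (pauliN d n a)ᴴ).trace +
     ((O * H - H * O) * (pauliN d n a)ᴴ).trace * (O * pauliN d n a).trace) *
    (Real.logb 2 (pdist d n O a) : ℂ)

/-- Extend an operator on the first `k` qudits by the identity: `H₀ ⊗ I`. -/
def extendOp (d k n : ℕ) (h : k ≤ n) (H0 : QOp d k) : QOp d n :=
  fun x y => if ∀ i : Fin n, k ≤ (i : ℕ) → x i = y i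
    then H0 (fun i => x (Fin.castLE h i)) (fun i => y (Fin.castLE h i)) else 0

/-- The tensor product `A ⊗ B` of an `n₁`-qudit and an `n₂`-qudit operator. -/
def tensorOp (d n₁ n₂ : ℕ) (A : QOp d n₁) (B : QOp d n₂) : QOp d (n₁ + n₂) :=
  fun x y => A (fun i => x (Fin.castAdd n₂ i)) (fun i => y (Fin.castAdd n₂ i)) *
             B (fun i => x (Fin.natAdd n₁ i)) (fun i => y (Fin.natAdd n₁ i))

/-- Embed a single-qudit operator `W` at position `j` (identity elsewhere). -/
def embedAt (d n : ℕ) (j : Fin n) (W : Matrix (Fin d) (Fin d) ℂ) : QOp d n :=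
  fun x y => if ∀ i, i ≠ j → x i = y i then W (x j) (y j) else 0

/-- The swap unitary exchanging qudits `i` and `j`. -/
def swapOp (d n : ℕ) (i j : Fin n) : QOp d n :=
  fun x y => if x = y ∘ Equiv.swap i j then 1 else 0

/-- The qubit Pauli X matrix. -/
def pauliX : Matrix (Fin 2) (Fin 2) ℂ := !![0, 1; 1, 0]

/-- The qubit Pauli Y matrix. -/
def pauliY : Matrix (Fin 2) (Fin 2) ℂ := !![0, -Complex.I; Complex.I, 0]

/-- The qubit Pauli Z matrix. -/
def pauliZ : Matrix (Fin 2) (Fin 2) ℂ := !![1, 0; 0, -1]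

/-- The ordered product `γ^S = ∏_{i∈S} γ_i` (factors in increasing index order). -/
def gammaProd (n : ℕ) (γ : Fin (2 * n) → QOp 2 n) (S : Finset (Fin (2 * n))) : QOp 2 n :=
  ((S.sort (· ≤ ·)).map γ).prod

/-- `P^G_O[S] = |Tr((γ^S)† O)|² / 2^{2n}`. -/
def pdistG (n : ℕ) (γ : Fin (2 * n) → QOp 2 n) (O : QOp 2 n) (S : Finset (Fin (2 * n))) : ℝ :=
  ‖((gammaProd n γ S)ᴴ * O).trace‖ ^ 2 / (2 : ℝ) ^ (2 * n)

/-- The Gaussian influence `I^G[O] = Σ_S |S|·P^G_O[S]`. -/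
def influenceG (n : ℕ) (γ : Fin (2 * n) → QOp 2 n) (O : QOp 2 n) : ℝ :=
  ∑ S : Finset (Fin (2 * n)), (S.card : ℝ) * pdistG n γ O S

/-- The Gaussian Fourier entropy `H^G[O] = -Σ_S P^G_O[S] log₂ P^G_O[S]`. -/
def entropyG (n : ℕ) (γ : Fin (2 * n) → QOp 2 n) (O : QOp 2 n) : ℝ :=
  -∑ S : Finset (Fin (2 * n)), pdistG n γ O S * Real.logb 2 (pdistG n γ O S)

/-- Gaussian circuit sensitivity `CiS^G[U] = sup { |I^G[UOU†] - I^G[O]| : ‖O‖₂ = 1 }`. -/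
def CiSG (n : ℕ) (γ : Fin (2 * n) → QOp 2 n) (U : QOp 2 n) : ℝ :=
  sSup {x : ℝ | ∃ O : QOp 2 n, l2norm 2 n O = 1 ∧
    x = |influenceG n γ (U * O * Uᴴ) - influenceG n γ O|}

/-- Fourier coefficient `f̂(S)` of a Boolean function `f : {-1,1}^n → ℝ`, with
the domain encoded as `Fin n → Bool` (`true ↦ -1`, `false ↦ 1`). -/
def fourierCoeff (n : ℕ) (f : (Fin n → Bool) → ℝ) (S : Finset (Fin n)) : ℝ :=
  (∑ x : Fin n → Bool, f x * ∏ i ∈ S, (if x i then -1 else 1)) / 2 ^ n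

/-- Fourier entropy of a Boolean function. -/
def boolEntropy (n : ℕ) (f : (Fin n → Bool) → ℝ) : ℝ :=
  -∑ S : Finset (Fin n), (fourierCoeff n f S) ^ 2 * Real.logb 2 ((fourierCoeff n f S) ^ 2)

/-- Total influence of a Boolean function. -/
def boolInfluence (n : ℕ) (f : (Fin n → Bool) → ℝ) : ℝ :=
  ∑ S : Finset (Fin n), (S.card : ℝ) * (fourierCoeff n f S) ^ 2

/-- The completely dephasing channel `Δ`. -/
def dephase (d n : ℕ) (A : QOp d n) : QOp d n :=
  Matrix.diagonal (fun i => A i i)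

/-- The diagonal matrix `log₂ Δ(ρ)` (entrywise base-2 logarithm of the diagonal). -/
def logDephase (d n : ℕ) (A : QOp d n) : QOp d n :=
  Matrix.diagonal (fun i => (Real.logb 2 (A i i).re : ℂ))

/-- The coherence rate `R_C(H,ρ) = -i Tr([ρ, log Δ(ρ)] H)`. -/
def cohRate (d n : ℕ) (H ρ : QOp d n) : ℂ :=
  -Complex.I * ((ρ * logDephase d n ρ - logDephase d n ρ * ρ) * H).trace

/-- The max-relative entropy `D_max(ρ‖σ) = log₂ min{λ > 0 : ρ ≤ λσ}`. -/
def Dmax (d n : ℕ) (ρ σ : QOp d n) : ℝ :=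
  Real.logb 2 (sInf {l : ℝ | 0 < l ∧ ((l : ℂ) • σ - ρ).PosSemidef})

/-- The squared Frobenius norm `Tr(M†M)`. -/
def frobSq {ι : Type*} [Fintype ι] (M : Matrix ι ι ℂ) : ℝ := (Mᴴ * M).trace.re

/-- The family `P` satisfies the completeness relation of an orthogonal operator basis whose
members have squared Frobenius norm `c`. -/
def IsTightFrame {ι α : Type*} [Fintype α] [DecidableEq ι] (P : α → Matrix ι ι ℂ) (c : ℝ) : Prop :=
  ∀ x y x' y', ∑ a, P a x y * star (P a x' y') = if x = x' ∧ y = y' then (c : ℂ) else 0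

/-- The quadratic form `∑ₐ w(a) |Tr(M Pₐ)|²`. -/
def weightedForm {ι α : Type*} [Fintype ι] [Fintype α] (w : α → ℝ) (P : α → Matrix ι ι ℂ)
    (M : Matrix ι ι ℂ) : ℝ :=
  ∑ a, w a * ‖(M * P a).trace‖ ^ 2

/-- The partial trace `Tr₂(O (1 ⊗ Q))`. -/
def partialTrace {ι κ : Type*} [Fintype κ] (O : Matrix (ι × κ) (ι × κ) ℂ) (Q : Matrix κ κ ℂ) :
    Matrix ι ι ℂ :=
  fun x x' => ∑ y, ∑ y', O (x, y) (x', y') * Q y' y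

section Frames

open scoped Kronecker

lemma IsTightFrame.kronecker {ι κ α β : Type*} [Fintype α] [Fintype β] [DecidableEq ι]
    [DecidableEq κ] {P : α → Matrix ι ι ℂ} {Q : β → Matrix κ κ ℂ} {c c' : ℝ}
    (hP : IsTightFrame P c) (hQ : IsTightFrame Q c') :
    IsTightFrame (fun p : α × β => P p.1 ⊗ₖ Q p.2) (c * c') := by
  rintro ⟨x₁, x₂⟩ ⟨y₁, y₂⟩ ⟨x₁', x₂'⟩ ⟨y₁', y₂'⟩
  simp only [Matrix.kroneckerMap_apply, star_mul', Fintype.sum_prod_type]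
  have h := congrArg₂ (· * ·) (hP x₁ y₁ x₁' y₁') (hQ x₂ y₂ x₂' y₂')
  simp only [Finset.sum_mul_sum] at h
  convert h using 1
  · exact Finset.sum_congr rfl fun a _ => Finset.sum_congr rfl fun b _ => by ring
  · simp only [Prod.mk.injEq]
    push_cast
    grind

variable {ι κ α β : Type*} [Fintype ι] [Fintype κ] [Fintype α] [Fintype β]

lemma frobSq_eq_sum (M : Matrix ι ι ℂ) : frobSq M = ∑ p : ι × ι, ‖M p.1 p.2‖ ^ 2 := by
  simp only [frobSq, Matrix.trace, Matrix.diag, Matrix.mul_apply, Matrix.conjTranspose_apply,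
    Complex.re_sum, Fintype.sum_prod_type]
  rw [Finset.sum_comm]
  refine Finset.sum_congr rfl fun x _ => Finset.sum_congr rfl fun y _ => ?_
  rw [Complex.sq_norm, Complex.normSq_apply]
  simp

lemma frobSq_nonneg (M : Matrix ι ι ℂ) : 0 ≤ frobSq M := by
  rw [frobSq_eq_sum]; positivity

lemma frobSq_submatrix (e : ι ≃ κ) (M : Matrix κ κ ℂ) : frobSq (M.submatrix e e) = frobSq M := by
  rw [frobSq_eq_sum, frobSq_eq_sum]
  exact Fintype.sum_equiv (e.prodCongr e) _ _ fun _ => rfl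

lemma frobSq_conj [DecidableEq ι] {U : Matrix ι ι ℂ} (hU : Uᴴ * U = 1) (M : Matrix ι ι ℂ) :
    frobSq (U * M * Uᴴ) = frobSq M := by
  have h : (U * M * Uᴴ)ᴴ * (U * M * Uᴴ) = U * (Mᴴ * (Uᴴ * U) * M * Uᴴ) := by
    simp only [Matrix.conjTranspose_mul, Matrix.conjTranspose_conjTranspose, Matrix.mul_assoc]
  rw [frobSq, h, Matrix.trace_mul_comm, hU, Matrix.mul_one, Matrix.mul_assoc, hU, Matrix.mul_one,
    frobSq]

lemma IsTightFrame.parseval [DecidableEq ι] {P : α → Matrix ι ι ℂ} {c : ℝ} (hP : IsTightFrame P c)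
    (M : Matrix ι ι ℂ) : ∑ a, ‖(M * P a).trace‖ ^ 2 = c * frobSq M := by
  have htr (a : α) : (M * P a).trace = ∑ p : ι × ι, M p.1 p.2 * P a p.2 p.1 := by
    simp [Matrix.trace, Matrix.mul_apply, Fintype.sum_prod_type]
  rw [frobSq_eq_sum]
  apply Complex.ofReal_injective
  push_cast
  have hsq (z : ℂ) : (‖z‖ : ℂ) ^ 2 = z * star z := (Complex.mul_conj' z).symm
  simp only [hsq, htr, star_sum, star_mul', Finset.sum_mul_sum]
  rw [Finset.sum_comm, Finset.mul_sum]
  refine Finset.sum_congr rfl fun p _ => ?_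
  rw [Finset.sum_comm]
  have hinner (q : ι × ι) :
      ∑ a, M p.1 p.2 * P a p.2 p.1 * (star (M q.1 q.2) * star (P a q.2 q.1)) =
        if p = q then M p.1 p.2 * star (M q.1 q.2) * c else 0 := by
    have hpq : (p.2 = q.2 ∧ p.1 = q.1) ↔ p = q := by rw [Prod.ext_iff, and_comm]
    calc _ = M p.1 p.2 * star (M q.1 q.2) * ∑ a, P a p.2 p.1 * star (P a q.2 q.1) := by
          rw [Finset.mul_sum]
          exact Finset.sum_congr rfl fun a _ => by ring
      _ = _ := by rw [hP]; simp only [hpq]; split_ifs <;> simp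
  simp only [hinner, Finset.sum_ite_eq, Finset.mem_univ, if_true]
  ring

lemma trace_mul_kronecker (O : Matrix (ι × κ) (ι × κ) ℂ) (P : Matrix ι ι ℂ) (Q : Matrix κ κ ℂ) :
    (O * (P ⊗ₖ Q)).trace = (partialTrace O Q * P).trace := by
  simp only [Matrix.trace, Matrix.diag, Matrix.mul_apply, partialTrace, Fintype.sum_prod_type,
    Matrix.kroneckerMap_apply, Finset.sum_mul]
  refine Finset.sum_congr rfl fun x _ => ?_
  rw [Finset.sum_comm]
  refine Finset.sum_congr rfl fun x' _ => Finset.sum_congr rfl fun y _ =>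
    Finset.sum_congr rfl fun y' _ => by ring

lemma trace_swap_mul_kronecker (O : Matrix (ι × κ) (ι × κ) ℂ) (P : Matrix ι ι ℂ)
    (Q : Matrix κ κ ℂ) :
    (O.submatrix Prod.swap Prod.swap * (Q ⊗ₖ P)).trace = (O * (P ⊗ₖ Q)).trace := by
  have h : Q ⊗ₖ P = (P ⊗ₖ Q).submatrix Prod.swap Prod.swap := by
    ext i j; simp [mul_comm]
  rw [h]
  change (O.submatrix _ (Equiv.prodComm κ ι) * (P ⊗ₖ Q).submatrix (Equiv.prodComm κ ι) _).trace = _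
  rw [Matrix.submatrix_mul_equiv]
  exact Fintype.sum_equiv (Equiv.prodComm κ ι) _ _ fun _ => rfl

lemma trace_conj_mul (U M P : Matrix ι ι ℂ) :
    (U * M * Uᴴ * P).trace = (M * (Uᴴ * P * U)).trace := by
  rw [Matrix.mul_assoc, Matrix.mul_assoc, Matrix.trace_mul_comm]
  simp only [Matrix.mul_assoc]

lemma trace_kronecker_conj_mul (U : Matrix ι ι ℂ) (V : Matrix κ κ ℂ)
    (O : Matrix (ι × κ) (ι × κ) ℂ) (P : Matrix ι ι ℂ) (Q : Matrix κ κ ℂ) :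
    ((U ⊗ₖ V) * O * (U ⊗ₖ V)ᴴ * (P ⊗ₖ Q)).trace =
      (O * ((Uᴴ * P * U) ⊗ₖ (Vᴴ * Q * V))).trace := by
  rw [trace_conj_mul, Matrix.conjTranspose_kronecker, ← Matrix.mul_kronecker_mul,
    ← Matrix.mul_kronecker_mul]

/-- Conjugating by `U ⊗ V` changes a weighted form supported on the first factor by no more than
conjugating by `U` does. -/
lemma abs_weightedForm_fst_conj_sub_le [DecidableEq ι] [DecidableEq κ] {P : α → Matrix ι ι ℂ}
    {Q : β → Matrix κ κ ℂ} {c c' C : ℝ} (hc : 0 < c) (hP : IsTightFrame P c)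
    (hQ : IsTightFrame Q c') (w : α → ℝ) (U : Matrix ι ι ℂ) {V : Matrix κ κ ℂ}
    (hV : Vᴴ * V = 1)
    (hC : ∀ M, |weightedForm w P (U * M * Uᴴ) - weightedForm w P M| ≤ C * frobSq M)
    (O : Matrix (ι × κ) (ι × κ) ℂ) :
    |weightedForm (fun p : α × β => w p.1) (fun p => P p.1 ⊗ₖ Q p.2)
        ((U ⊗ₖ V) * O * (U ⊗ₖ V)ᴴ) -
      weightedForm (fun p : α × β => w p.1) (fun p => P p.1 ⊗ₖ Q p.2) O| ≤
      C * c' * frobSq O := by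
  have hconj : weightedForm (fun p : α × β => w p.1) (fun p => P p.1 ⊗ₖ Q p.2)
      ((U ⊗ₖ V) * O * (U ⊗ₖ V)ᴴ) = ∑ b, weightedForm w P (U * partialTrace O (Q b) * Uᴴ) := by
    simp only [weightedForm, Fintype.sum_prod_type]
    rw [Finset.sum_comm (γ := β)]
    refine Finset.sum_congr rfl fun a _ => ?_
    rw [← Finset.mul_sum, ← Finset.mul_sum]
    congr 1
    set N := partialTrace (O.submatrix Prod.swap Prod.swap) (Uᴴ * P a * U) with hN
    have h₁ (b : β) : ((U ⊗ₖ V) * O * (U ⊗ₖ V)ᴴ * (P a ⊗ₖ Q b)).trace =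
        (V * N * Vᴴ * Q b).trace := by
      rw [trace_kronecker_conj_mul, ← trace_swap_mul_kronecker, trace_mul_kronecker,
        trace_conj_mul]
    have h₂ (b : β) : (U * partialTrace O (Q b) * Uᴴ * P a).trace = (N * Q b).trace := by
      rw [trace_conj_mul, ← trace_mul_kronecker, ← trace_swap_mul_kronecker, trace_mul_kronecker]
    simp only [h₁, h₂]
    rw [hQ.parseval, hQ.parseval, frobSq_conj hV]
  have hid : weightedForm (fun p : α × β => w p.1) (fun p => P p.1 ⊗ₖ Q p.2) O =
      ∑ b, weightedForm w P (partialTrace O (Q b)) := by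
    simp only [weightedForm, Fintype.sum_prod_type, trace_mul_kronecker]
    rw [Finset.sum_comm]
  have hnorm : ∑ b, frobSq (partialTrace O (Q b)) = c' * frobSq O := by
    have h := (hP.kronecker hQ).parseval O
    simp only [Fintype.sum_prod_type, trace_mul_kronecker] at h
    rw [Finset.sum_comm] at h
    simp only [hP.parseval] at h
    rw [← Finset.mul_sum, mul_assoc] at h
    exact mul_left_cancel₀ hc.ne' h
  rw [hconj, hid, ← Finset.sum_sub_distrib, mul_assoc, ← hnorm, Finset.mul_sum]
  exact (Finset.abs_sum_le_sum_abs _ _).trans (Finset.sum_le_sum fun b _ => hC _)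

lemma weightedForm_swap (v : β → ℝ) (P : α → Matrix ι ι ℂ) (Q : β → Matrix κ κ ℂ)
    (O : Matrix (ι × κ) (ι × κ) ℂ) :
    weightedForm (fun p : β × α => v p.1) (fun p => Q p.1 ⊗ₖ P p.2)
        (O.submatrix Prod.swap Prod.swap) =
      weightedForm (fun p : α × β => v p.2) (fun p => P p.1 ⊗ₖ Q p.2) O := by
  simp only [weightedForm, trace_swap_mul_kronecker]
  exact Fintype.sum_equiv (Equiv.prodComm β α) _ _ fun _ => rfl

lemma kronecker_conj_submatrix_swap (U : Matrix ι ι ℂ) (V : Matrix κ κ ℂ)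
    (O : Matrix (ι × κ) (ι × κ) ℂ) :
    ((U ⊗ₖ V) * O * (U ⊗ₖ V)ᴴ).submatrix Prod.swap Prod.swap =
      (V ⊗ₖ U) * O.submatrix Prod.swap Prod.swap * (V ⊗ₖ U)ᴴ := by
  have h : V ⊗ₖ U = (U ⊗ₖ V).submatrix (Equiv.prodComm κ ι) (Equiv.prodComm κ ι) := by
    ext i j; simp [mul_comm]
  rw [h, Matrix.conjTranspose_submatrix]
  change ((U ⊗ₖ V) * O * (U ⊗ₖ V)ᴴ).submatrix (Equiv.prodComm κ ι) (Equiv.prodComm κ ι) =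
    _ * O.submatrix (Equiv.prodComm κ ι) (Equiv.prodComm κ ι) * _
  rw [Matrix.submatrix_mul_equiv, Matrix.submatrix_mul_equiv]

lemma abs_weightedForm_kronecker_conj_sub_le [DecidableEq ι] [DecidableEq κ]
    {P : α → Matrix ι ι ℂ} {Q : β → Matrix κ κ ℂ} {c c' C C' : ℝ} (hc : 0 < c) (hc' : 0 < c')
    (hP : IsTightFrame P c) (hQ : IsTightFrame Q c') (w : α → ℝ) (v : β → ℝ)
    {U : Matrix ι ι ℂ} {V : Matrix κ κ ℂ} (hU : Uᴴ * U = 1) (hV : Vᴴ * V = 1)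
    (hC : ∀ M, |weightedForm w P (U * M * Uᴴ) - weightedForm w P M| ≤ C * frobSq M)
    (hC' : ∀ M, |weightedForm v Q (V * M * Vᴴ) - weightedForm v Q M| ≤ C' * frobSq M)
    (O : Matrix (ι × κ) (ι × κ) ℂ) :
    |weightedForm (fun p : α × β => w p.1 + v p.2) (fun p => P p.1 ⊗ₖ Q p.2)
        ((U ⊗ₖ V) * O * (U ⊗ₖ V)ᴴ) -
      weightedForm (fun p : α × β => w p.1 + v p.2) (fun p => P p.1 ⊗ₖ Q p.2) O| ≤
      (C * c' + C' * c) * frobSq O := by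
  have hadd (O : Matrix (ι × κ) (ι × κ) ℂ) :
      weightedForm (fun p : α × β => w p.1 + v p.2) (fun p => P p.1 ⊗ₖ Q p.2) O =
        weightedForm (fun p : α × β => w p.1) (fun p => P p.1 ⊗ₖ Q p.2) O +
        weightedForm (fun p : α × β => v p.2) (fun p => P p.1 ⊗ₖ Q p.2) O := by
    simp only [weightedForm, add_mul, Finset.sum_add_distrib]
  have h₁ := abs_weightedForm_fst_conj_sub_le hc hP hQ w U hV hC O
  have h₂ := abs_weightedForm_fst_conj_sub_le hc' hQ hP v V hU hC' (O.submatrix Prod.swap Prod.swap)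
  rw [← kronecker_conj_submatrix_swap, weightedForm_swap, weightedForm_swap,
    show frobSq (O.submatrix Prod.swap Prod.swap) = frobSq O from
      frobSq_submatrix (Equiv.prodComm κ ι) O] at h₂
  rw [hadd, hadd, add_sub_add_comm, add_mul]
  exact (abs_add_le _ _).trans (add_le_add h₁ h₂)

end Frames

section Pauli

lemma shiftX_pow_apply (k s : ℕ) (i j : Fin (k + 1)) :
    (shiftX (k + 1) ^ s) i j = if i = j + Fin.ofNat (k + 1) s then 1 else 0 := by
  induction s generalizing i j with
  | zero => simp [Matrix.one_apply]
  | succ s ih =>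
    have hshift (i j : Fin (k + 1)) : shiftX (k + 1) i j = if i = j + 1 then 1 else 0 := by
      simp [shiftX, Fin.ext_iff, Fin.val_add]
    have hadd : j + 1 + Fin.ofNat (k + 1) s = j + Fin.ofNat (k + 1) (s + 1) := by
      simp [Fin.ext_iff, Fin.val_add, add_assoc, add_comm 1 s]
    rw [pow_succ, Matrix.mul_apply]
    simp only [ih, hshift, mul_ite, mul_one, mul_zero, Finset.sum_ite_eq', Finset.mem_univ,
      if_true, hadd]

lemma pauli1_apply (k : ℕ) (s t : Fin (k + 1)) (i j : Fin (k + 1)) :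
    pauli1 (k + 1) (s, t) i j =
      if i = j + s then (Complex.exp (2 * Real.pi * Complex.I / (k + 1 : ℕ)) ^ (j : ℕ)) ^ (t : ℕ)
      else 0 := by
  change (shiftX (k + 1) ^ (s : ℕ) * clockZ (k + 1) ^ (t : ℕ)) i j = _
  rw [clockZ, Matrix.diagonal_pow, Matrix.mul_diagonal, shiftX_pow_apply, Fin.ofNat_val_eq_self,
    ite_mul, one_mul, zero_mul]
  congr 1
  rw [Pi.pow_apply, ← Complex.exp_nat_mul _ (j : ℕ)]
  congr 2
  ring

lemma isTightFrame_pauli1_succ (k : ℕ) : IsTightFrame (pauli1 (k + 1)) (k + 1 : ℕ) := by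
  intro x y x' y'
  have hω := Complex.isPrimitiveRoot_exp (k + 1) k.succ_ne_zero
  set ω := Complex.exp (2 * Real.pi * Complex.I / (k + 1 : ℕ)) with hω_def
  have hnorm : ω * star ω = 1 := by
    have h : ‖ω‖ = 1 := hω.norm'_eq_one k.succ_ne_zero
    rw [show ω * star ω = (‖ω‖ : ℂ) ^ 2 from Complex.mul_conj' ω, h]; simp
  have hphase : ∑ t : Fin (k + 1), (ω ^ (y : ℕ)) ^ (t : ℕ) * star ((ω ^ (y' : ℕ)) ^ (t : ℕ)) =
      if y = y' then ((k + 1 : ℕ) : ℂ) else 0 := by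
    simp only [star_pow, ← mul_pow]
    set ζ := ω ^ (y : ℕ) * star ω ^ (y' : ℕ) with hζ
    have hcancel : ζ * ω ^ (y' : ℕ) = ω ^ (y : ℕ) := by
      rw [hζ, mul_assoc, ← mul_pow, mul_comm (star ω), hnorm, one_pow, mul_one]
    split_ifs with h
    · subst h
      have : ζ = 1 := by rw [hζ, ← mul_pow, hnorm, one_pow]
      simp [this]
    · have hne : ζ ≠ 1 := by
        intro h1
        rw [h1, one_mul] at hcancel
        exact h (Fin.ext (hω.pow_inj y.2 y'.2 hcancel.symm))
      have hpow : ζ ^ (k + 1) = 1 := by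
        rw [hζ, mul_pow, pow_right_comm, pow_right_comm (star ω), ← star_pow, hω.pow_eq_one]
        simp
      rw [Fin.sum_univ_eq_sum_range (fun t => ζ ^ t), geom_sum_eq hne, hpow, sub_self, zero_div]
  change ∑ a : Fin (k + 1) × Fin (k + 1), _ = _
  rw [Fintype.sum_prod_type]
  have hrow (s : Fin (k + 1)) :
      ∑ t : Fin (k + 1), pauli1 (k + 1) (s, t) x y * star (pauli1 (k + 1) (s, t) x' y') =
        if s = x - y then (if x' = y' + s then if y = y' then ((k + 1 : ℕ) : ℂ) else 0 else 0)
        else 0 := by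
    rw [← hphase]
    simp only [pauli1_apply, ← hω_def]
    have hiff : s = x - y ↔ x = y + s := by
      rw [eq_sub_iff_add_eq, add_comm s y, eq_comm]
    simp only [hiff]
    split_ifs <;> simp
  refine (Finset.sum_congr rfl fun s _ => hrow s).trans ?_
  rw [Finset.sum_ite_eq' Finset.univ (x - y), if_pos (Finset.mem_univ _)]
  by_cases hy : y = y'
  · subst hy
    simp [eq_comm]
  · simp [hy]

lemma isTightFrame_pauli1 (d : ℕ) [NeZero d] : IsTightFrame (pauli1 d) d := by
  obtain ⟨k, rfl⟩ := Nat.exists_eq_succ_of_ne_zero (NeZero.ne d)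
  exact isTightFrame_pauli1_succ k

lemma isTightFrame_pauliN (d n : ℕ) [NeZero d] : IsTightFrame (pauliN d n) ((d : ℝ) ^ n) := by
  intro x y x' y'
  simp only [pauliN, star_prod, ← Finset.prod_mul_distrib]
  have h := Finset.prod_univ_sum (fun _ : Fin n => (Finset.univ : Finset (ZMod d × ZMod d)))
    (fun i a => pauli1 d a (x i) (y i) * star (pauli1 d a (x' i) (y' i)))
  rw [Fintype.piFinset_univ] at h
  rw [← h]
  simp only [isTightFrame_pauli1 d _ _ _ _]
  split_ifs with hxy
  · obtain ⟨rfl, rfl⟩ := hxy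
    simp
  · have : ∃ i, ¬(x i = x' i ∧ y i = y' i) := by
      by_contra! hall
      exact hxy ⟨funext fun i => (hall i).1, funext fun i => (hall i).2⟩
    obtain ⟨i, hi⟩ := this
    exact Finset.prod_eq_zero (Finset.mem_univ i) (if_neg hi)

end Pauli

section Sensitivity

open scoped Kronecker

variable {d n : ℕ}

lemma l2norm_eq (O : QOp d n) : l2norm d n O = √(frobSq O / (d : ℝ) ^ n) := rfl

lemma l2norm_conj {U : QOp d n} (hU : Uᴴ * U = 1) (O : QOp d n) :
    l2norm d n (U * O * Uᴴ) = l2norm d n O := by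
  rw [l2norm_eq, l2norm_eq, frobSq_conj hU]

variable [NeZero d]

lemma influence_eq_weightedForm (O : QOp d n) :
    influence d n O = weightedForm (fun a => (weight d n a : ℝ)) (pauliN d n) O /
      (d : ℝ) ^ (2 * n) := by
  simp only [influence, pdist, weightedForm, Finset.sum_div, mul_div_assoc]

lemma l2norm_eq_one_iff (O : QOp d n) : l2norm d n O = 1 ↔ frobSq O = (d : ℝ) ^ n := by
  have hd : (d : ℝ) ^ n ≠ 0 := pow_ne_zero _ (NeZero.ne _)
  rw [l2norm_eq, Real.sqrt_eq_one, div_eq_one_iff_eq hd]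

lemma influence_nonneg (O : QOp d n) : 0 ≤ influence d n O := by
  unfold influence pdist; positivity

lemma influence_le {O : QOp d n} (hO : l2norm d n O = 1) : influence d n O ≤ n := by
  have hd : (0 : ℝ) < (d : ℝ) ^ n := pow_pos (Nat.cast_pos.2 (NeZero.pos d)) _
  have hw (a : Fin n → ZMod d × ZMod d) : (weight d n a : ℝ) ≤ n := by
    exact_mod_cast (Finset.card_filter_le _ _).trans (by simp)
  have h : weightedForm (fun a => (weight d n a : ℝ)) (pauliN d n) O ≤
      n * ((d : ℝ) ^ n * frobSq O) := by
    rw [← (isTightFrame_pauliN d n).parseval, Finset.mul_sum]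
    exact Finset.sum_le_sum fun a _ => mul_le_mul_of_nonneg_right (hw a) (sq_nonneg _)
  rw [influence_eq_weightedForm, div_le_iff₀ (by rw [two_mul, pow_add]; positivity)]
  rwa [(l2norm_eq_one_iff O).1 hO, ← pow_add, ← two_mul] at h

lemma CiS_nonneg (U : QOp d n) : 0 ≤ CiS d n U :=
  Real.sSup_nonneg (by rintro _ ⟨O, -, rfl⟩; exact abs_nonneg _)

lemma abs_influence_sub_le_CiS {U : QOp d n} (hU : Uᴴ * U = 1) {O : QOp d n}
    (hO : l2norm d n O = 1) :
    |influence d n (U * O * Uᴴ) - influence d n O| ≤ CiS d n U := by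
  refine le_csSup ⟨n, ?_⟩ ⟨O, hO, rfl⟩
  rintro _ ⟨A, hA, rfl⟩
  exact abs_sub_le_of_nonneg_of_le (influence_nonneg _)
    (influence_le ((l2norm_conj hU A).trans hA)) (influence_nonneg _) (influence_le hA)

lemma CiS_mul_le {U V : QOp d n} (hU : Uᴴ * U = 1) (hV : Vᴴ * V = 1) :
    CiS d n (U * V) ≤ CiS d n U + CiS d n V := by
  refine Real.sSup_le ?_ (add_nonneg (CiS_nonneg U) (CiS_nonneg V))
  rintro _ ⟨O, hO, rfl⟩
  have h : U * V * O * (U * V)ᴴ = U * (V * O * Vᴴ) * Uᴴ := by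
    simp only [Matrix.conjTranspose_mul, Matrix.mul_assoc]
  rw [h]
  exact (abs_sub_le _ (influence d n (V * O * Vᴴ)) _).trans
    (add_le_add (abs_influence_sub_le_CiS hU ((l2norm_conj hV O).trans hO))
      (abs_influence_sub_le_CiS hV hO))

lemma weightedForm_smul {ι α : Type*} [Fintype ι] [Fintype α] (w : α → ℝ)
    (P : α → Matrix ι ι ℂ) (r : ℝ) (M : Matrix ι ι ℂ) :
    weightedForm w P ((r : ℂ) • M) = r ^ 2 * weightedForm w P M := by
  simp only [weightedForm, Matrix.smul_mul, Matrix.trace_smul, norm_smul, mul_pow,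
    Complex.norm_real, Real.norm_eq_abs, sq_abs, Finset.mul_sum]
  exact Finset.sum_congr rfl fun a _ => by ring

lemma frobSq_smul {ι : Type*} [Fintype ι] (r : ℝ) (M : Matrix ι ι ℂ) :
    frobSq ((r : ℂ) • M) = r ^ 2 * frobSq M := by
  simp [frobSq_eq_sum, mul_pow, Finset.mul_sum]

lemma abs_weightedForm_sub_le_CiS {U : QOp d n} (hU : Uᴴ * U = 1) (M : QOp d n) :
    |weightedForm (fun a => (weight d n a : ℝ)) (pauliN d n) (U * M * Uᴴ) -
      weightedForm (fun a => (weight d n a : ℝ)) (pauliN d n) M| ≤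
      CiS d n U * (d : ℝ) ^ n * frobSq M := by
  have hd : (0 : ℝ) < (d : ℝ) ^ n := pow_pos (Nat.cast_pos.2 (NeZero.pos d)) _
  rcases (frobSq_nonneg M).eq_or_lt with h0 | hpos
  · have hM : M = 0 := by
      rw [frobSq_eq_sum, eq_comm, Finset.sum_eq_zero_iff_of_nonneg fun _ _ => sq_nonneg _] at h0
      ext i j
      simpa using h0 (i, j) (Finset.mem_univ _)
    simp [hM, frobSq]
  · set r : ℝ := √((d : ℝ) ^ n / frobSq M) with hr
    have hr2 : r ^ 2 = (d : ℝ) ^ n / frobSq M := Real.sq_sqrt (by positivity)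
    have hO : l2norm d n ((r : ℂ) • M) = 1 := by
      rw [l2norm_eq_one_iff, frobSq_smul, hr2, div_mul_cancel₀ _ hpos.ne']
    have h := abs_influence_sub_le_CiS hU hO
    rw [influence_eq_weightedForm, influence_eq_weightedForm, Matrix.mul_smul, Matrix.smul_mul,
      weightedForm_smul, weightedForm_smul, ← sub_div, ← mul_sub, abs_div, abs_mul,
      abs_of_nonneg (sq_nonneg r), hr2, two_mul, pow_add, abs_of_pos (mul_pos hd hd),
      div_le_iff₀ (mul_pos hd hd), div_mul_eq_mul_div, div_le_iff₀ hpos] at h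
    nlinarith

lemma CiS_tensorOp_le {n₁ n₂ : ℕ} {U : QOp d n₁} {V : QOp d n₂} (hU : Uᴴ * U = 1)
    (hV : Vᴴ * V = 1) :
    CiS d (n₁ + n₂) (tensorOp d n₁ n₂ U V) ≤ CiS d n₁ U + CiS d n₂ V := by
  refine Real.sSup_le ?_ (add_nonneg (CiS_nonneg U) (CiS_nonneg V))
  rintro _ ⟨O, hO, rfl⟩
  have hd (m : ℕ) : (0 : ℝ) < (d : ℝ) ^ m := pow_pos (Nat.cast_pos.2 (NeZero.pos d)) _
  let e : (Fin n₁ → Fin d) × (Fin n₂ → Fin d) ≃ (Fin (n₁ + n₂) → Fin d) :=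
    Fin.appendEquiv n₁ n₂
  have htensor : (tensorOp d n₁ n₂ U V).submatrix e e = U ⊗ₖ V := by
    ext x y
    simp [tensorOp, e, Fin.appendEquiv]
  have hpauli (a : (Fin n₁ → ZMod d × ZMod d) × (Fin n₂ → ZMod d × ZMod d)) :
      (pauliN d (n₁ + n₂) (Fin.appendEquiv n₁ n₂ a)).submatrix e e =
        pauliN d n₁ a.1 ⊗ₖ pauliN d n₂ a.2 := by
    ext x y
    simp [pauliN, e, Fin.appendEquiv, Fin.prod_univ_add]
  have hweight (a : (Fin n₁ → ZMod d × ZMod d) × (Fin n₂ → ZMod d × ZMod d)) :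
      weight d (n₁ + n₂) (Fin.appendEquiv n₁ n₂ a) = weight d n₁ a.1 + weight d n₂ a.2 := by
    simp only [weight, Finset.card_filter]
    simp [Fin.sum_univ_add, Fin.appendEquiv]
  have hform (A : QOp d (n₁ + n₂)) :
      weightedForm (fun a => (weight d (n₁ + n₂) a : ℝ)) (pauliN d (n₁ + n₂)) A =
        weightedForm (fun p : (Fin n₁ → ZMod d × ZMod d) × (Fin n₂ → ZMod d × ZMod d) =>
            (weight d n₁ p.1 : ℝ) + weight d n₂ p.2)
          (fun p => pauliN d n₁ p.1 ⊗ₖ pauliN d n₂ p.2) (A.submatrix e e) := by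
    refine (Fintype.sum_equiv (Fin.appendEquiv n₁ n₂) _ _ fun a => ?_).symm
    dsimp only
    rw [hweight, ← hpauli, Matrix.submatrix_mul_equiv, Nat.cast_add]
    congr 3
    exact Fintype.sum_equiv e _ _ fun _ => rfl
  have hconj : (tensorOp d n₁ n₂ U V * O * (tensorOp d n₁ n₂ U V)ᴴ).submatrix e e =
      (U ⊗ₖ V) * O.submatrix e e * (U ⊗ₖ V)ᴴ := by
    rw [← htensor, Matrix.conjTranspose_submatrix, Matrix.submatrix_mul_equiv,
      Matrix.submatrix_mul_equiv]
  have h := abs_weightedForm_kronecker_conj_sub_le (hd n₁) (hd n₂) (isTightFrame_pauliN d n₁)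
    (isTightFrame_pauliN d n₂) (fun a => (weight d n₁ a : ℝ)) (fun a => (weight d n₂ a : ℝ))
    hU hV (abs_weightedForm_sub_le_CiS hU) (abs_weightedForm_sub_le_CiS hV) (O.submatrix e e)
  rw [frobSq_submatrix, (l2norm_eq_one_iff O).1 hO, ← hconj, ← hform, ← hform] at h
  have hD : (0 : ℝ) < (d : ℝ) ^ (2 * (n₁ + n₂)) := hd _
  rw [influence_eq_weightedForm, influence_eq_weightedForm, ← sub_div, abs_div, abs_of_pos hD,
    div_le_iff₀ hD]
  refine h.trans_eq ?_
  ring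

end Sensitivity

/-- Circuit sensitivity is subadditive under multiplication and under tensorization. -/
theorem cis_subadditive (d : ℕ) (hd : 2 ≤ d) [NeZero d] :
    (∀ (n : ℕ) (U V : QOp d n),
      U ∈ Matrix.unitaryGroup (Fin n → Fin d) ℂ →
      V ∈ Matrix.unitaryGroup (Fin n → Fin d) ℂ →
      CiS d n (U * V) ≤ CiS d n U + CiS d n V) ∧
    (∀ (n₁ n₂ : ℕ) (U : QOp d n₁) (V : QOp d n₂),
      U ∈ Matrix.unitaryGroup (Fin n₁ → Fin d) ℂ →
      V ∈ Matrix.unitaryGroup (Fin n₂ → Fin d) ℂ →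
      CiS d (n₁ + n₂) (tensorOp d n₁ n₂ U V) ≤ CiS d n₁ U + CiS d n₂ V) := by
  refine ⟨fun n U V hU hV => ?_, fun n₁ n₂ U V hU hV => ?_⟩
  · exact CiS_mul_le (Matrix.mem_unitaryGroup_iff'.1 hU) (Matrix.mem_unitaryGroup_iff'.1 hV)
  · exact CiS_tensorOp_le (Matrix.mem_unitaryGroup_iff'.1 hU) (Matrix.mem_unitaryGroup_iff'.1 hV)

end QC
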